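/- Let n ≥ 1. The period domain Ω_{3,n}, with its subspace topology inside ℙ(ℂ^{3+n}), is a simply connected topological space (it is path-connected and has trivial fundamental group). -/

import Mathlib

open scoped BigOperators

noncomputable section

/-- The standard symmetric bilinear form of signature `(3, n)` on `ℝ^{3+n}`. -/
def B3n (n : ℕ) (x y : Fin (n + 3) → ℝ) : ℝ :=
  ∑ i : Fin (n + 3), (if (i : ℕ) < 3 then (1 : ℝ) else -1) * x i * y i

/-- The complex-bilinear extension of `B3n` to `ℂ^{3+n}`. -/
def B3nC (n : ℕ) (v w : Fin (n + 3) → ℂ) : ℂ :=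
  ∑ i : Fin (n + 3), (if (i : ℕ) < 3 then (1 : ℂ) else -1) * v i * w i

/-- Coordinatewise complex conjugation on `ℂ^{3+n}`. -/
def conjVec (n : ℕ) (v : Fin (n + 3) → ℂ) : Fin (n + 3) → ℂ :=
  fun i => (starRingEnd ℂ) (v i)

/-- The quotient topology on a projectivization. -/
instance projectivizationTopology (K V : Type*) [DivisionRing K] [AddCommGroup V] [Module K V]
    [TopologicalSpace V] : TopologicalSpace (Projectivization K V) :=
  instTopologicalSpaceQuotient

/-- The period domain `Ω_{3,n}` : the set of lines `[v]` in `ℙ(ℂ^{3+n})` with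
`B_ℂ(v,v) = 0` and `B_ℂ(v, v̄) > 0` (the latter quantity is automatically real,
so positivity is expressed via its real part). -/
def Omega (n : ℕ) : Set (Projectivization ℂ (Fin (n + 3) → ℂ)) :=
  {p | B3nC n p.rep p.rep = 0 ∧ 0 < (B3nC n p.rep (conjVec n p.rep)).re}

open Topology

theorem Projectivization.isOpenQuotientMap_mk' (K V : Type*) [DivisionRing K] [AddCommGroup V]
    [Module K V] [TopologicalSpace V] [ContinuousConstSMul K V] :
    IsOpenQuotientMap (Projectivization.mk' K : {v : V // v ≠ 0} → Projectivization K V) := by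
  have hq : IsQuotientMap (Projectivization.mk' K : {v : V // v ≠ 0} → Projectivization K V) :=
    isQuotientMap_quotient_mk'
  refine .of_isOpenMap_isQuotientMap (fun s hs => ?_) hq
  rw [← hq.isOpen_preimage]
  have hsmul (a : Kˣ) : Continuous fun v : {v : V // v ≠ 0} =>
      (⟨a • v.1, (smul_ne_zero_iff_ne a).2 v.2⟩ : {v : V // v ≠ 0}) :=
    Continuous.subtype_mk (continuous_subtype_val.const_smul (a : K)) _
  convert isOpen_iUnion fun a : Kˣ => hs.preimage (hsmul a) using 1
  ext v
  simp only [Set.mem_preimage, Set.mem_image, Set.mem_iUnion, mk'_eq_mk, mk_eq_mk_iff]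
  constructor
  · rintro ⟨w, hw, a, ha⟩
    exact ⟨a, by simpa only [ha] using hw⟩
  · rintro ⟨a, ha⟩
    exact ⟨_, ha, a, rfl⟩

theorem Topology.IsEmbedding.of_leftInverse_of_continuousAt {X Y : Type*} [TopologicalSpace X]
    [TopologicalSpace Y] {f : X → Y} {g : Y → X} (hgf : Function.LeftInverse g f)
    (hf : Continuous f) (hg : ∀ x, ContinuousAt g (f x)) : IsEmbedding f := by
  refine ⟨isInducing_iff_nhds.2 fun x => le_antisymm hf.continuousAt.le_comap ?_, hgf.injective⟩
  refine (Filter.comap_mono (hg x).le_comap).trans ?_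
  rw [Filter.comap_comap, hgf.comp_eq_id, hgf x, Filter.comap_id]

section Form

variable {n : ℕ}

theorem B3nC_comm (v w : Fin (n + 3) → ℂ) : B3nC n v w = B3nC n w v :=
  Finset.sum_congr rfl fun _ _ => mul_right_comm _ _ _

theorem B3nC_add_left (u v w : Fin (n + 3) → ℂ) :
    B3nC n (u + v) w = B3nC n u w + B3nC n v w := by
  simp only [B3nC, Pi.add_apply, mul_add, add_mul, Finset.sum_add_distrib]

theorem B3nC_smul_left (a : ℂ) (v w : Fin (n + 3) → ℂ) :
    B3nC n (a • v) w = a * B3nC n v w := by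
  simp only [B3nC, Pi.smul_apply, smul_eq_mul, Finset.mul_sum]
  exact Finset.sum_congr rfl fun _ _ => by ring

theorem B3nC_add_right (u v w : Fin (n + 3) → ℂ) :
    B3nC n u (v + w) = B3nC n u v + B3nC n u w := by
  simp only [B3nC_comm u, B3nC_add_left]

theorem B3nC_smul_right (a : ℂ) (v w : Fin (n + 3) → ℂ) :
    B3nC n v (a • w) = a * B3nC n v w := by
  simp only [B3nC_comm v, B3nC_smul_left]

theorem conjVec_add (v w : Fin (n + 3) → ℂ) :
    conjVec n (v + w) = conjVec n v + conjVec n w := by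
  ext i; simp [conjVec]

theorem conjVec_smul (a : ℂ) (v : Fin (n + 3) → ℂ) :
    conjVec n (a • v) = starRingEnd ℂ a • conjVec n v := by
  ext i; simp [conjVec]

theorem conjVec_conjVec (v : Fin (n + 3) → ℂ) : conjVec n (conjVec n v) = v := by
  ext i; simp [conjVec]

theorem B3nC_conjVec (v w : Fin (n + 3) → ℂ) :
    B3nC n (conjVec n v) (conjVec n w) = starRingEnd ℂ (B3nC n v w) := by
  simp [B3nC, conjVec, apply_ite (starRingEnd ℂ)]

/-- The Hermitian square `B_ℂ(v, v̄)`, as a real number. -/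
def hermSq (v : Fin (n + 3) → ℂ) : ℝ := (B3nC n v (conjVec n v)).re

theorem ofReal_hermSq (v : Fin (n + 3) → ℂ) : (hermSq v : ℂ) = B3nC n v (conjVec n v) := by
  rw [hermSq, ← Complex.conj_eq_iff_re, ← B3nC_conjVec, conjVec_conjVec, B3nC_comm]

theorem hermSq_smul (a : ℂ) (v : Fin (n + 3) → ℂ) : hermSq (a • v) = ‖a‖ ^ 2 * hermSq v := by
  apply Complex.ofReal_injective
  push_cast
  rw [ofReal_hermSq, ofReal_hermSq, conjVec_smul, B3nC_smul_left, B3nC_smul_right, ← mul_assoc,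
    Complex.mul_conj']

theorem B3nC_smul_self (a : ℂ) (v : Fin (n + 3) → ℂ) :
    B3nC n (a • v) (a • v) = a ^ 2 * B3nC n v v := by
  rw [B3nC_smul_left, B3nC_smul_right, ← mul_assoc, sq]

@[fun_prop]
theorem continuous_B3nC_self : Continuous fun v : Fin (n + 3) → ℂ => B3nC n v v := by
  unfold B3nC; fun_prop

@[fun_prop]
theorem continuous_conjVec : Continuous (conjVec n) := by
  unfold conjVec; fun_prop

@[fun_prop]
theorem continuous_hermSq : Continuous (hermSq : (Fin (n + 3) → ℂ) → ℝ) := by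
  unfold hermSq B3nC; fun_prop

/-- A vector `v` with `B_ℂ(v, v) = 0` and `B_ℂ(v, v̄) > 0`. -/
def IsPeriodVector (v : Fin (n + 3) → ℂ) : Prop := B3nC n v v = 0 ∧ 0 < hermSq v

theorem IsPeriodVector.ne_zero {v : Fin (n + 3) → ℂ} (hv : IsPeriodVector v) : v ≠ 0 := by
  rintro rfl
  simpa [hermSq, B3nC] using hv.2

theorem isPeriodVector_smul_iff {a : ℂ} (ha : a ≠ 0) {v : Fin (n + 3) → ℂ} :
    IsPeriodVector (a • v) ↔ IsPeriodVector v := by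
  have : 0 < ‖a‖ ^ 2 := by positivity
  simp [IsPeriodVector, B3nC_smul_self, hermSq_smul, ha, this]

theorem mk_mem_Omega_iff {v : Fin (n + 3) → ℂ} (hv : v ≠ 0) :
    Projectivization.mk ℂ v hv ∈ Omega n ↔ IsPeriodVector v := by
  obtain ⟨a, ha⟩ := Projectivization.exists_smul_eq_mk_rep ℂ v hv
  rw [← isPeriodVector_smul_iff a.ne_zero, ← Units.smul_def, ha]
  rfl

theorem isPeriodVector_rep (x : Omega n) : IsPeriodVector x.1.rep := x.2

/-- The denominator of `isotropicCoeff`. -/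
def isotropicDenom (v : Fin (n + 3) → ℂ) : ℝ :=
  hermSq v + √(hermSq v ^ 2 - ‖B3nC n v v‖ ^ 2)

/-- The coefficient `c` for which `v + c v̄` is isotropic. -/
def isotropicCoeff (v : Fin (n + 3) → ℂ) : ℂ := -B3nC n v v / isotropicDenom v

/-- An isotropic vector in the span of `v` and `v̄`, when that span is the complexification of a
positive definite real plane. -/
def isotropicVector (v : Fin (n + 3) → ℂ) : Fin (n + 3) → ℂ :=
  v + isotropicCoeff v • conjVec n v

theorem isotropicDenom_pos {v : Fin (n + 3) → ℂ} (hv : 0 < hermSq v) : 0 < isotropicDenom v := by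
  unfold isotropicDenom; positivity

theorem isotropicVector_of_isotropic {v : Fin (n + 3) → ℂ} (hv : B3nC n v v = 0) :
    isotropicVector v = v := by
  simp [isotropicVector, isotropicCoeff, hv]

theorem isotropicVector_smul {a : ℂ} (ha : a ≠ 0) (v : Fin (n + 3) → ℂ) :
    isotropicVector (a • v) = a • isotropicVector v := by
  have hden : isotropicDenom (a • v) = ‖a‖ ^ 2 * isotropicDenom v := by
    rw [isotropicDenom, isotropicDenom, hermSq_smul, B3nC_smul_self, norm_mul, norm_pow,
      show (‖a‖ ^ 2 * hermSq v) ^ 2 - (‖a‖ ^ 2 * ‖B3nC n v v‖) ^ 2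
        = (‖a‖ ^ 2) ^ 2 * (hermSq v ^ 2 - ‖B3nC n v v‖ ^ 2) by ring,
      Real.sqrt_mul (by positivity), Real.sqrt_sq (by positivity), mul_add]
  have hcoeff : isotropicCoeff (a • v) * starRingEnd ℂ a = a * isotropicCoeff v := by
    have hc : starRingEnd ℂ a ≠ 0 := by simpa using ha
    rw [isotropicCoeff, isotropicCoeff, hden, B3nC_smul_self]
    push_cast
    rw [← Complex.mul_conj']
    field_simp
  rw [isotropicVector, isotropicVector, conjVec_smul, smul_smul, hcoeff, smul_add, smul_smul]

theorem isPeriodVector_isotropicVector {v : Fin (n + 3) → ℂ} (hv : ‖B3nC n v v‖ < hermSq v) :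
    IsPeriodVector (isotropicVector v) := by
  have hpos : 0 < hermSq v := (norm_nonneg _).trans_lt hv
  have hD := isotropicDenom_pos hpos
  have hlt : ‖B3nC n v v‖ ^ 2 < hermSq v ^ 2 := by gcongr
  have hquad : isotropicDenom v ^ 2 - 2 * hermSq v * isotropicDenom v + ‖B3nC n v v‖ ^ 2 = 0 := by
    have := Real.sq_sqrt (sub_nonneg.2 hlt.le)
    unfold isotropicDenom
    linear_combination this
  have hquadC : (isotropicDenom v : ℂ) ^ 2 - 2 * hermSq v * isotropicDenom v
      + B3nC n v v * starRingEnd ℂ (B3nC n v v) = 0 := by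
    rw [Complex.mul_conj']
    exact_mod_cast hquad
  have hDC : (isotropicDenom v : ℂ) ≠ 0 := by exact_mod_cast hD.ne'
  have hherm : hermSq (isotropicVector v)
      = 2 * (hermSq v ^ 2 - ‖B3nC n v v‖ ^ 2) / isotropicDenom v := by
    apply Complex.ofReal_injective
    push_cast
    rw [ofReal_hermSq, ← Complex.mul_conj']
    simp only [isotropicVector, conjVec_add, conjVec_smul, conjVec_conjVec, B3nC_add_left,
      B3nC_add_right, B3nC_smul_left, B3nC_smul_right, B3nC_conjVec, B3nC_comm (conjVec n v) v,
      ← ofReal_hermSq, isotropicCoeff, map_div₀, map_neg, Complex.conj_ofReal]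
    field_simp
    linear_combination (hermSq v : ℂ) * hquadC
  refine ⟨?_, ?_⟩
  · simp only [isotropicVector, B3nC_add_left, B3nC_add_right, B3nC_smul_left, B3nC_smul_right,
      B3nC_conjVec, B3nC_comm (conjVec n v) v, ← ofReal_hermSq, isotropicCoeff]
    field_simp
    linear_combination (B3nC n v v : ℂ) * hquadC
  · rw [hherm]
    have := sub_pos.2 hlt
    positivity

/-- Multiplication of the negative definite coordinates by `t`. -/
def scaleNeg (t : ℝ) (v : Fin (n + 3) → ℂ) : Fin (n + 3) → ℂ :=
  fun i => if (i : ℕ) < 3 then v i else t * v i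

theorem scaleNeg_one (v : Fin (n + 3) → ℂ) : scaleNeg 1 v = v := by
  ext i; simp [scaleNeg]

theorem scaleNeg_smul (t : ℝ) (a : ℂ) (v : Fin (n + 3) → ℂ) :
    scaleNeg t (a • v) = a • scaleNeg t v := by
  ext i
  simp only [scaleNeg, Pi.smul_apply, smul_eq_mul]
  split_ifs <;> ring

@[fun_prop]
theorem continuous_scaleNeg :
    Continuous fun p : ℝ × (Fin (n + 3) → ℂ) => scaleNeg p.1 p.2 := by
  refine continuous_pi fun i => ?_
  unfold scaleNeg
  split_ifs <;> fun_prop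

theorem IsPeriodVector.norm_lt_hermSq_scaleNeg {v : Fin (n + 3) → ℂ} (hv : IsPeriodVector v)
    {t : ℝ} (ht0 : 0 ≤ t) (ht1 : t ≤ 1) :
    ‖B3nC n (scaleNeg t v) (scaleNeg t v)‖ < hermSq (scaleNeg t v) := by
  let S : ℂ := ∑ i : Fin (n + 3), if (i : ℕ) < 3 then v i ^ 2 else 0
  let T : ℂ := ∑ i : Fin (n + 3), if (i : ℕ) < 3 then 0 else v i ^ 2
  let P : ℝ := ∑ i : Fin (n + 3), if (i : ℕ) < 3 then ‖v i‖ ^ 2 else 0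
  let N : ℝ := ∑ i : Fin (n + 3), if (i : ℕ) < 3 then 0 else ‖v i‖ ^ 2
  have hB (s : ℝ) : B3nC n (scaleNeg s v) (scaleNeg s v) = S - s ^ 2 * T := by
    simp only [S, T, B3nC, scaleNeg, Finset.mul_sum, ← Finset.sum_sub_distrib]
    refine Finset.sum_congr rfl fun i _ => ?_
    split_ifs <;> ring
  have hH (s : ℝ) : hermSq (scaleNeg s v) = P - s ^ 2 * N := by
    apply Complex.ofReal_injective
    rw [ofReal_hermSq]
    simp only [P, N, B3nC, scaleNeg, conjVec, Finset.mul_sum, ← Finset.sum_sub_distrib]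
    push_cast
    refine Finset.sum_congr rfl fun i _ => ?_
    split_ifs
    · simp [← Complex.mul_conj']
    · simp [← Complex.mul_conj']
      ring
  have hTN : ‖T‖ ≤ N := by
    refine (norm_sum_le _ _).trans (Finset.sum_le_sum fun i _ => ?_)
    split_ifs <;> simp
  have hST : S = T := by
    have := hB 1
    rw [scaleNeg_one, hv.1, Complex.ofReal_one] at this
    linear_combination -this
  have hNP : N < P := by
    have := hH 1
    rw [scaleNeg_one] at this
    linarith [hv.2]
  have ht : 0 ≤ 1 - t ^ 2 := by nlinarith
  have hnorm : ‖S - t ^ 2 * T‖ = (1 - t ^ 2) * ‖T‖ := by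
    rw [hST, show T - (t : ℂ) ^ 2 * T = ((1 - t ^ 2 : ℝ) : ℂ) * T by push_cast; ring, norm_mul,
      Complex.norm_real, Real.norm_of_nonneg ht]
  rw [hB, hH, hnorm]
  nlinarith [mul_le_mul_of_nonneg_left hTN ht]

end Form

theorem IsSimplyConnected.homotopic {X : Type*} [TopologicalSpace X] {s : Set X}
    (hs : IsSimplyConnected s) {x y : X} (p q : Path x y) (hp : ∀ t, p t ∈ s)
    (hq : ∀ t, q t ∈ s) : p.Homotopic q := by
  have := hs.simplyConnectedSpace
  have hx : x ∈ s := by simpa using hp 0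
  have hy : y ∈ s := by simpa using hp 1
  let p' : Path (⟨x, hx⟩ : s) ⟨y, hy⟩ :=
    { toFun := fun t => ⟨p t, hp t⟩, source' := by simp, target' := by simp }
  let q' : Path (⟨x, hx⟩ : s) ⟨y, hy⟩ :=
    { toFun := fun t => ⟨q t, hq t⟩, source' := by simp, target' := by simp }
  exact (SimplyConnectedSpace.paths_homotopic p' q').map ⟨Subtype.val, continuous_subtype_val⟩

theorem Path.trans_mem {X : Type*} [TopologicalSpace X] {s : Set X} {x y z : X}
    {p : Path x y} {q : Path y z} (hp : ∀ t, p t ∈ s) (hq : ∀ t, q t ∈ s) (t : unitInterval) :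
    p.trans q t ∈ s := by
  rw [Path.trans_apply]
  split_ifs
  exacts [hp _, hq _]

/-- A space covered by simply connected open sets with a common point and path-connected pairwise
intersections is simply connected. -/
theorem simplyConnectedSpace_of_isOpen_cover {X ι : Type*} [TopologicalSpace X] {U : ι → Set X}
    (hopen : ∀ i, IsOpen (U i)) (hcover : ∀ x, ∃ i, x ∈ U i)
    (hsc : ∀ i, IsSimplyConnected (U i)) (hinter : ∀ i j, IsPathConnected (U i ∩ U j))
    {b : X} (hb : ∀ i, b ∈ U i) : SimplyConnectedSpace X := by
  have hjoin (x : X) (i j : ι) (hi : x ∈ U i) (hj : x ∈ U j) :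
      ∃ γ : Path b x, (∀ t, γ t ∈ U i) ∧ ∀ t, γ t ∈ U j :=
    let h := (hinter i j).joinedIn b ⟨hb i, hb j⟩ x ⟨hi, hj⟩
    ⟨h.somePath, fun t => (h.somePath_mem t).1, fun t => (h.somePath_mem t).2⟩
  have hclass (x : X) : ∃ e : Path.Homotopic.Quotient b x,
      ∀ i, ∀ γ : Path b x, (∀ t, γ t ∈ U i) → Path.Homotopic.Quotient.mk γ = e := by
    obtain ⟨i₀, hi₀⟩ := hcover x
    obtain ⟨γ₀, hγ₀, -⟩ := hjoin x i₀ i₀ hi₀ hi₀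
    refine ⟨.mk γ₀, fun i γ hγ => Path.Homotopic.Quotient.eq.2 ?_⟩
    obtain ⟨δ, hδ, hδ₀⟩ := hjoin x i i₀ (by simpa using hγ 1) hi₀
    exact ((hsc i).homotopic γ δ hγ hδ).trans ((hsc i₀).homotopic δ γ₀ hδ₀ hγ₀)
  choose e he using hclass
  have hlocal {x y : X} (i : ι) (γ : Path x y) (hγ : ∀ t, γ t ∈ U i) :
      (e x).trans (.mk γ) = e y := by
    have hx : x ∈ U i := by simpa using hγ 0
    obtain ⟨δ, hδ, -⟩ := hjoin x i i hx hx
    rw [← he x i δ hδ, ← he y i (δ.trans γ) (Path.trans_mem hδ hγ),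
      Path.Homotopic.Quotient.mk_trans]
  have hcast {x y x' y' : X} (γ : Path x y) (hx : x' = x) (hy : y' = y)
      (h : (e x').trans (.mk (γ.cast hx hy)) = e y') : (e x).trans (.mk γ) = e y := by
    subst hx hy
    exact h
  have hglobal {x y : X} (γ : Path x y) : (e x).trans (.mk γ) = e y := by
    obtain ⟨t, ht0, hmono, ⟨N, hN⟩, hsub⟩ := exists_monotone_Icc_subset_open_cover_unitInterval
      (c := fun i => γ ⁻¹' U i) (fun i => (hopen i).preimage γ.continuous)
      (fun s _ => Set.mem_iUnion.2 (hcover (γ s)))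
    have hstep (k : ℕ) : (e (γ (t 0))).trans (.mk (γ.subpath (t 0) (t k))) = e (γ (t k)) := by
      induction k with
      | zero =>
        obtain ⟨i, hi⟩ := hcover (γ (t 0))
        exact hlocal i _ fun s => by simpa using hi
      | succ k ih =>
        obtain ⟨i, hi⟩ := hsub k
        have hk : ∀ s, γ.subpath (t k) (t (k + 1)) s ∈ U i := fun s => by
          have : γ.subpath (t k) (t (k + 1)) s ∈ Set.range (γ.subpath (t k) (t (k + 1))) := ⟨s, rfl⟩
          rw [Path.range_subpath_of_le _ _ _ (hmono k.le_succ)] at this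
          obtain ⟨r, hr, hrs⟩ := this
          exact hrs ▸ hi hr
        rw [← hlocal i _ hk, ← ih, ← Path.Homotopic.Quotient.eq.2
          ⟨Path.Homotopy.subpathTransSubpath γ (t 0) (t k) (t (k + 1))⟩]
        simp
    have hfin := hstep N
    rw [ht0, hN N le_rfl, Path.subpath_zero_one] at hfin
    exact hcast γ _ _ hfin
  rw [simply_connected_iff_paths_homotopic']
  refine ⟨⟨⟨b⟩, fun x y => ?_⟩, fun {x y} p q => Path.Homotopic.Quotient.eq.1 ?_⟩
  · have hbase (z : X) : Joined b z := ⟨(e z).out⟩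
    exact (hbase x).symm.trans (hbase y)
  · have h := congrArg (fun c => (e x).symm.trans c) ((hglobal p).trans (hglobal q).symm)
    simpa [← Path.Homotopic.Quotient.trans_assoc] using h

section PeriodDomain

variable {n : ℕ}

/-- The vector obtained from `v` by multiplying its negative definite coordinates by `t` and
correcting the result to an isotropic vector. -/
def contractVec (t : ℝ) (v : Fin (n + 3) → ℂ) : Fin (n + 3) → ℂ := isotropicVector (scaleNeg t v)

theorem contractVec_smul (t : ℝ) {a : ℂ} (ha : a ≠ 0) (v : Fin (n + 3) → ℂ) :
    contractVec t (a • v) = a • contractVec t v := by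
  rw [contractVec, contractVec, scaleNeg_smul, isotropicVector_smul ha]

theorem IsPeriodVector.contractVec {v : Fin (n + 3) → ℂ} (hv : IsPeriodVector v)
    (t : unitInterval) : IsPeriodVector (contractVec (t : ℝ) v) :=
  isPeriodVector_isotropicVector (hv.norm_lt_hermSq_scaleNeg t.2.1 t.2.2)

theorem contractVec_one {v : Fin (n + 3) → ℂ} (hv : B3nC n v v = 0) : contractVec 1 v = v := by
  rw [contractVec, scaleNeg_one, isotropicVector_of_isotropic hv]

theorem contractVec_zero_apply (v : Fin (n + 3) → ℂ) {i : Fin (n + 3)} (hi : 3 ≤ (i : ℕ)) :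
    contractVec 0 v i = 0 := by
  simp [contractVec, isotropicVector, scaleNeg, conjVec, hi.not_gt]

theorem contractVec_zero {v : Fin (n + 3) → ℂ} (hv : B3nC n v v = 0)
    (hneg : ∀ i : Fin (n + 3), 3 ≤ (i : ℕ) → v i = 0) : contractVec 0 v = v := by
  have : scaleNeg 0 v = v := by
    ext i
    by_cases hi : (i : ℕ) < 3
    · simp [scaleNeg, hi]
    · simp [scaleNeg, hi, hneg i (not_lt.1 hi)]
  rw [contractVec, this, isotropicVector_of_isotropic hv]

/-- The deformation of the period domain induced by `contractVec`. -/
def contractOmega (t : unitInterval) (x : Omega n) : Omega n :=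
  have h := (isPeriodVector_rep x).contractVec t
  ⟨Projectivization.mk ℂ _ h.ne_zero, (mk_mem_Omega_iff _).2 h⟩

theorem contractOmega_mk (t : unitInterval) {v : Fin (n + 3) → ℂ} (hv : v ≠ 0)
    (hmem : Projectivization.mk ℂ v hv ∈ Omega n) :
    (contractOmega t ⟨Projectivization.mk ℂ v hv, hmem⟩ : Projectivization ℂ (Fin (n + 3) → ℂ)) =
      Projectivization.mk ℂ _ (((mk_mem_Omega_iff hv).1 hmem).contractVec t).ne_zero := by
  obtain ⟨a, ha⟩ := Projectivization.exists_smul_eq_mk_rep ℂ v hv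
  refine (Projectivization.mk_eq_mk_iff ℂ _ _ _ _).2 ⟨a, ?_⟩
  rw [← ha, Units.smul_def, Units.smul_def, contractVec_smul _ a.ne_zero]

theorem continuous_contractOmega :
    Continuous fun p : unitInterval × Omega n => contractOmega p.1 p.2 := by
  have hq := IsOpenQuotientMap.id (X := unitInterval) |>.prodMap
    ((Projectivization.isOpenQuotientMap_mk' ℂ (Fin (n + 3) → ℂ)).restrictPreimage (Omega n))
  rw [← hq.continuous_comp_iff, continuous_induced_rng]
  have hperiod (p : unitInterval × (Projectivization.mk' ℂ ⁻¹' Omega n)) :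
      IsPeriodVector p.2.1.1 := (mk_mem_Omega_iff p.2.1.2).1 p.2.2
  have hcont : Continuous fun p : unitInterval × (Projectivization.mk' ℂ ⁻¹' Omega n) =>
      contractVec (p.1 : ℝ) p.2.1.1 := by
    have hs : Continuous fun p : unitInterval × (Projectivization.mk' ℂ ⁻¹' Omega n) =>
        scaleNeg (p.1 : ℝ) p.2.1.1 :=
      continuous_scaleNeg.comp (f := fun p : unitInterval × (Projectivization.mk' ℂ ⁻¹' Omega n) =>
        ((p.1 : ℝ), p.2.1.1)) (by fun_prop)
    unfold contractVec isotropicVector isotropicCoeff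
    refine hs.add (.fun_smul (Continuous.div ?_ (Complex.continuous_ofReal.comp ?_) fun p => ?_) ?_)
    · exact (continuous_B3nC_self.comp hs).neg
    · unfold isotropicDenom
      have h₁ := continuous_hermSq.comp hs
      have h₂ := continuous_B3nC_self.comp hs
      simp only [Function.comp_def] at h₁ h₂
      fun_prop
    · have h := (hperiod p).norm_lt_hermSq_scaleNeg p.1.2.1 p.1.2.2
      exact_mod_cast (isotropicDenom_pos ((norm_nonneg _).trans_lt h)).ne'
    · exact continuous_conjVec.comp hs
  refine ((Projectivization.isOpenQuotientMap_mk' ℂ (Fin (n + 3) → ℂ)).continuous.comp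
    (hcont.subtype_mk fun p => ((hperiod p).contractVec p.1).ne_zero)).congr fun p => ?_
  exact (contractOmega_mk p.1 p.2.1.2 p.2.2).symm

/-- The lines of the period domain contained in the complexified positive definite coordinate
space. -/
def OmegaConic (n : ℕ) : Set (Omega n) :=
  {x | ∀ i : Fin (n + 3), 3 ≤ (i : ℕ) → x.1.rep i = 0}

theorem mk_mem_OmegaConic {v : Fin (n + 3) → ℂ} (hv : v ≠ 0)
    (hmem : Projectivization.mk ℂ v hv ∈ Omega n)
    (hneg : ∀ i : Fin (n + 3), 3 ≤ (i : ℕ) → v i = 0) :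
    (⟨Projectivization.mk ℂ v hv, hmem⟩ : Omega n) ∈ OmegaConic n := by
  obtain ⟨a, ha⟩ := Projectivization.exists_smul_eq_mk_rep ℂ v hv
  intro i hi
  simp [← ha, hneg i hi]

theorem contractOmega_one (x : Omega n) : contractOmega 1 x = x := by
  apply Subtype.ext
  simp [contractOmega, contractVec_one (isPeriodVector_rep x).1]

theorem contractOmega_zero_mem (x : Omega n) : contractOmega 0 x ∈ OmegaConic n :=
  mk_mem_OmegaConic _ _ fun _ hi => contractVec_zero_apply _ hi

theorem contractOmega_zero_of_mem {x : Omega n} (hx : x ∈ OmegaConic n) :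
    contractOmega 0 x = x := by
  apply Subtype.ext
  simp [contractOmega, contractVec_zero (isPeriodVector_rep x).1 hx]

/-- The period domain deformation retracts onto `OmegaConic`. -/
def omegaHomotopyEquivConic (n : ℕ) : ContinuousMap.HomotopyEquiv (Omega n) (OmegaConic n) where
  toFun := ⟨fun x => ⟨contractOmega 0 x, contractOmega_zero_mem x⟩,
    (continuous_contractOmega.comp (Continuous.prodMk_right 0)).subtype_mk _⟩
  invFun := ⟨Subtype.val, continuous_subtype_val⟩
  left_inv := ⟨
    { toFun := fun p => contractOmega p.1 p.2
      continuous_toFun := continuous_contractOmega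
      map_zero_left := fun _ => rfl
      map_one_left := contractOmega_one }⟩
  right_inv := by
    convert ContinuousMap.Homotopic.refl (ContinuousMap.id (OmegaConic n)) using 1
    ext1 x
    exact Subtype.ext (contractOmega_zero_of_mem x.2)

theorem B3nC_of_neg_eq_zero {v : Fin (n + 3) → ℂ}
    (hneg : ∀ i : Fin (n + 3), 3 ≤ (i : ℕ) → v i = 0) (w : Fin (n + 3) → ℂ) :
    B3nC n v w = v 0 * w 0 + v 1 * w 1 + v 2 * w 2 := by
  have h (i : Fin n) : v i.succ.succ.succ = 0 := hneg _ (by simp)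
  rw [B3nC, Fin.sum_univ_succ, Fin.sum_univ_succ, Fin.sum_univ_succ]
  simp [h, add_assoc, Nat.mod_eq_of_lt (show 2 < n + 3 by omega)]

theorem isPeriodVector_of_neg_eq_zero {v : Fin (n + 3) → ℂ}
    (hneg : ∀ i : Fin (n + 3), 3 ≤ (i : ℕ) → v i = 0)
    (hsq : v 0 * v 0 + v 1 * v 1 + v 2 * v 2 = 0) (hne : v 0 ≠ 0 ∨ v 1 ≠ 0) :
    IsPeriodVector v := by
  refine ⟨by rw [B3nC_of_neg_eq_zero hneg, hsq], ?_⟩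
  have h : hermSq v = ‖v 0‖ ^ 2 + ‖v 1‖ ^ 2 + ‖v 2‖ ^ 2 := by
    apply Complex.ofReal_injective
    rw [ofReal_hermSq, B3nC_of_neg_eq_zero hneg]
    push_cast
    simp only [conjVec, Complex.mul_conj']
  rw [h]
  rcases hne with h | h
  all_goals
    have := norm_pos_iff.2 h
    positivity

/-- The rational parametrization of the affine conic, for a square root `j` of `-1`. -/
def conicVec (n : ℕ) (j z : ℂ) : Fin (n + 3) → ℂ := fun i =>
  if (i : ℕ) = 0 then 1 - z ^ 2 else if (i : ℕ) = 1 then j * (1 + z ^ 2)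
  else if (i : ℕ) = 2 then 2 * z else 0

theorem conicVec_zero (j z : ℂ) : conicVec n j z 0 = 1 - z ^ 2 := by simp [conicVec]

theorem conicVec_one (j z : ℂ) : conicVec n j z 1 = j * (1 + z ^ 2) := by simp [conicVec]

theorem conicVec_two (j z : ℂ) : conicVec n j z 2 = 2 * z := by
  simp [conicVec, Nat.mod_eq_of_lt (show 2 < n + 3 by omega)]

theorem conicVec_neg (j z : ℂ) (i : Fin (n + 3)) (hi : 3 ≤ (i : ℕ)) : conicVec n j z i = 0 := by
  simp [conicVec, show (i : ℕ) ≠ 0 by omega, show (i : ℕ) ≠ 1 by omega, show (i : ℕ) ≠ 2 by omega]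

@[fun_prop]
theorem continuous_conicVec (j : ℂ) : Continuous (conicVec n j) := by
  refine continuous_pi fun i => ?_
  unfold conicVec
  split_ifs <;> fun_prop

/-- The coordinate `v₀ - j v₁`, whose nonvanishing locus is the domain of a chart of the conic. -/
def chartDenom (j : ℂ) (v : Fin (n + 3) → ℂ) : ℂ := v 0 - j * v 1

theorem chartDenom_smul (j a : ℂ) (v : Fin (n + 3) → ℂ) :
    chartDenom j (a • v) = a * chartDenom j v := by
  simp only [chartDenom, Pi.smul_apply, smul_eq_mul]; ring

@[fun_prop]
theorem continuous_chartDenom (j : ℂ) :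
    Continuous (chartDenom j : (Fin (n + 3) → ℂ) → ℂ) := by
  unfold chartDenom; fun_prop

theorem chartDenom_conicVec {j : ℂ} (hj : j * j = -1) (z : ℂ) :
    chartDenom j (conicVec n j z) = 2 := by
  rw [chartDenom, conicVec_zero, conicVec_one]
  linear_combination -(1 + z ^ 2) * hj

theorem isPeriodVector_conicVec {j : ℂ} (hj : j * j = -1) (z : ℂ) :
    IsPeriodVector (conicVec n j z) := by
  refine isPeriodVector_of_neg_eq_zero (conicVec_neg j z) ?_ ?_
  · rw [conicVec_zero, conicVec_one, conicVec_two]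
    linear_combination (1 + z ^ 2) ^ 2 * hj
  · by_contra! h
    have := chartDenom_conicVec (n := n) hj z
    simp [chartDenom, h.1, h.2] at this

/-- The affine chart of the conic given by `conicVec`. -/
def conicChart (n : ℕ) (j : {j : ℂ // j * j = -1}) (z : ℂ) : OmegaConic n :=
  have h := isPeriodVector_conicVec (n := n) j.2 z
  ⟨⟨Projectivization.mk ℂ _ h.ne_zero, (mk_mem_Omega_iff _).2 h⟩,
    mk_mem_OmegaConic _ _ (conicVec_neg _ _)⟩

/-- The inverse of `conicChart`, as a function on projective space. -/
def chartCoord (j : ℂ) (p : Projectivization ℂ (Fin (n + 3) → ℂ)) : ℂ :=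
  p.rep 2 / chartDenom j p.rep

theorem chartCoord_mk (j : ℂ) {v : Fin (n + 3) → ℂ} (hv : v ≠ 0) :
    chartCoord j (Projectivization.mk ℂ v hv) = v 2 / chartDenom j v := by
  obtain ⟨a, ha⟩ := Projectivization.exists_smul_eq_mk_rep ℂ v hv
  rw [chartCoord, ← ha, Units.smul_def, chartDenom_smul, Pi.smul_apply, smul_eq_mul,
    mul_div_mul_left _ _ a.ne_zero]

theorem chartDenom_rep_mk_ne_zero_iff (j : ℂ) {v : Fin (n + 3) → ℂ} (hv : v ≠ 0) :
    chartDenom j (Projectivization.mk ℂ v hv).rep ≠ 0 ↔ chartDenom j v ≠ 0 := by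
  obtain ⟨a, ha⟩ := Projectivization.exists_smul_eq_mk_rep ℂ v hv
  rw [← ha, Units.smul_def, chartDenom_smul, mul_ne_zero_iff_left a.ne_zero]

theorem continuousAt_chartCoord_mk (j : ℂ) {v : Fin (n + 3) → ℂ} (hv : v ≠ 0)
    (hd : chartDenom j v ≠ 0) : ContinuousAt (chartCoord j) (Projectivization.mk ℂ v hv) := by
  have hq := Projectivization.isOpenQuotientMap_mk' ℂ (Fin (n + 3) → ℂ)
  refine (hq.continuousAt_comp_iff (x := ⟨v, hv⟩)).1 ?_
  have : chartCoord j ∘ Projectivization.mk' ℂ =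
      fun w : {w : Fin (n + 3) → ℂ // w ≠ 0} => w.1 2 / chartDenom j w.1 :=
    funext fun w => chartCoord_mk j w.2
  rw [this]
  exact ContinuousAt.div ((continuous_apply 2).comp continuous_subtype_val).continuousAt
    ((continuous_chartDenom j).comp continuous_subtype_val).continuousAt hd

theorem isEmbedding_conicChart (j : {j : ℂ // j * j = -1}) : IsEmbedding (conicChart n j) := by
  refine .of_leftInverse_of_continuousAt (g := fun x => chartCoord j x.1.1) (fun z => ?_) ?_
    fun z => ?_
  · simp only [conicChart]
    rw [chartCoord_mk, conicVec_two, chartDenom_conicVec j.2]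
    simp
  · refine Continuous.subtype_mk (Continuous.subtype_mk ?_ _) _
    exact (Projectivization.isOpenQuotientMap_mk' ℂ _).continuous.comp
      ((continuous_conicVec _).subtype_mk fun z => (isPeriodVector_conicVec j.2 z).ne_zero)
  · refine ContinuousAt.comp (g := chartCoord j.1) (x := conicChart n j z)
      (f := fun x : OmegaConic n => x.1.1) ?_
      (continuous_subtype_val.comp continuous_subtype_val).continuousAt
    refine continuousAt_chartCoord_mk _ _ ?_
    rw [chartDenom_conicVec j.2]
    exact two_ne_zero

theorem OmegaConic.rep_sq_sum (x : OmegaConic n) :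
    x.1.1.rep 0 * x.1.1.rep 0 + x.1.1.rep 1 * x.1.1.rep 1 + x.1.1.rep 2 * x.1.1.rep 2 = 0 := by
  rw [← B3nC_of_neg_eq_zero x.2]
  exact x.1.2.1

theorem conicChart_chartCoord (j : {j : ℂ // j * j = -1}) {x : OmegaConic n}
    (hx : chartDenom j x.1.1.rep ≠ 0) : conicChart n j (chartCoord j x.1.1) = x := by
  apply Subtype.ext
  apply Subtype.ext
  rw [conicChart]
  conv_rhs => rw [← x.1.1.mk_rep]
  refine (Projectivization.mk_eq_mk_iff' ℂ _ _ _ _).2 ⟨2 / chartDenom j x.1.1.rep, ?_⟩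
  have hsq := OmegaConic.rep_sq_sum x
  have hj := j.2
  ext i
  rw [Pi.smul_apply, smul_eq_mul, chartCoord]
  by_cases hi : 3 ≤ (i : ℕ)
  · rw [x.2 i hi, conicVec_neg _ _ i hi, mul_zero]
  have hcases : i = 0 ∨ i = 1 ∨ i = 2 := by
    have h2 : ((2 : Fin (n + 3)) : ℕ) = 2 := rfl
    simp only [Fin.ext_iff, Fin.val_zero, Fin.val_one, h2]
    omega
  rcases hcases with rfl | rfl | rfl
  · rw [conicVec_zero]
    field_simp
    rw [chartDenom]
    linear_combination hsq - x.1.1.rep 1 ^ 2 * hj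
  · rw [conicVec_one]
    field_simp
    rw [chartDenom]
    linear_combination -j.1 * hsq +
      (2 * x.1.1.rep 0 * x.1.1.rep 1 - j.1 * x.1.1.rep 1 ^ 2) * hj
  · rw [conicVec_two]
    field_simp

theorem range_conicChart (j : {j : ℂ // j * j = -1}) :
    Set.range (conicChart n j) = {x | chartDenom j x.1.1.rep ≠ 0} := by
  ext x
  refine ⟨?_, fun hx => ⟨_, conicChart_chartCoord j hx⟩⟩
  rintro ⟨z, rfl⟩
  exact (chartDenom_rep_mk_ne_zero_iff _ _).2 (by rw [chartDenom_conicVec j.2]; exact two_ne_zero)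

theorem isOpen_range_conicChart (j : {j : ℂ // j * j = -1}) :
    IsOpen (Set.range (conicChart n j)) := by
  have h : IsOpen {p : Projectivization ℂ (Fin (n + 3) → ℂ) | chartDenom j p.rep ≠ 0} := by
    rw [← (Projectivization.isOpenQuotientMap_mk' ℂ _).isQuotientMap.isOpen_preimage]
    have : Projectivization.mk' ℂ ⁻¹' {p : Projectivization ℂ (Fin (n + 3) → ℂ) |
        chartDenom j p.rep ≠ 0} = {v | chartDenom j v.1 ≠ 0} :=
      Set.ext fun v => chartDenom_rep_mk_ne_zero_iff _ v.2
    rw [this]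
    exact isOpen_ne_fun (by fun_prop) continuous_const
  rw [range_conicChart]
  exact h.preimage (continuous_subtype_val.comp continuous_subtype_val)

theorem isSimplyConnected_range_conicChart (j : {j : ℂ // j * j = -1}) :
    IsSimplyConnected (Set.range (conicChart n j)) := by
  rw [← Set.image_univ, (isEmbedding_conicChart j).isSimplyConnected_image]
  exact (Homeomorph.Set.univ ℂ).toHomotopyEquiv.simplyConnectedSpace

theorem conicChart_mem_range_neg_iff {i j : {j : ℂ // j * j = -1}} (hij : j.1 = -i.1) (z : ℂ) :
    conicChart n i z ∈ Set.range (conicChart n j) ↔ z ≠ 0 := by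
  rw [range_conicChart, Set.mem_ofPred_eq, conicChart, chartDenom_rep_mk_ne_zero_iff, chartDenom,
    conicVec_zero, conicVec_one, hij, show 1 - z ^ 2 - -i.1 * (i.1 * (1 + z ^ 2)) = -2 * z ^ 2 by
      linear_combination (1 + z ^ 2) * i.2]
  simp

theorem isPathConnected_range_conicChart_inter (i j : {j : ℂ // j * j = -1}) :
    IsPathConnected (Set.range (conicChart n i) ∩ Set.range (conicChart n j)) := by
  have hij : j.1 = i.1 ∨ j.1 = -i.1 := mul_self_eq_mul_self_iff.1 (j.2.trans i.2.symm)
  rcases hij with h | h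
  · obtain rfl : j = i := Subtype.ext h
    rw [Set.inter_self]
    exact (isSimplyConnected_range_conicChart j).isPathConnected
  · have : Set.range (conicChart n i) ∩ Set.range (conicChart n j) =
        Set.image (conicChart n i) {(0 : ℂ)}ᶜ := by
      ext x
      constructor
      · rintro ⟨⟨z, rfl⟩, hz⟩
        exact ⟨z, (conicChart_mem_range_neg_iff h z).1 hz, rfl⟩
      · rintro ⟨z, hz, rfl⟩
        exact ⟨⟨z, rfl⟩, (conicChart_mem_range_neg_iff h z).2 hz⟩
    rw [this]
    refine IsPathConnected.image ?_ (isEmbedding_conicChart i).continuous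
    exact isPathConnected_compl_singleton_of_one_lt_rank (by simp [Complex.rank_real_complex]) 0

theorem exists_mem_range_conicChart (x : OmegaConic n) : ∃ j, x ∈ Set.range (conicChart n j) := by
  by_contra! h
  simp only [range_conicChart, Set.mem_ofPred_eq, not_not] at h
  have h₁ := h ⟨Complex.I, Complex.I_mul_I⟩
  have h₂ := h ⟨-Complex.I, by simp⟩
  simp only [chartDenom] at h₁ h₂
  have h0 : x.1.1.rep 0 = 0 := by linear_combination (h₁ + h₂) / 2
  have h1 : x.1.1.rep 1 = 0 := by simpa [h0] using h₁
  have h2 : x.1.1.rep 2 = 0 := by simpa [h0, h1] using OmegaConic.rep_sq_sum x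
  have hpos := (isPeriodVector_rep x.1).2
  rw [hermSq, B3nC_of_neg_eq_zero x.2, h0, h1, h2] at hpos
  simp at hpos

instance simplyConnectedSpace_OmegaConic : SimplyConnectedSpace (OmegaConic n) := by
  let i : {j : ℂ // j * j = -1} := ⟨Complex.I, Complex.I_mul_I⟩
  refine simplyConnectedSpace_of_isOpen_cover isOpen_range_conicChart exists_mem_range_conicChart
    isSimplyConnected_range_conicChart isPathConnected_range_conicChart_inter
    (b := conicChart n i 1) fun j => ?_
  have hij : j.1 = i.1 ∨ j.1 = -i.1 := mul_self_eq_mul_self_iff.1 (j.2.trans i.2.symm)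
  rcases hij with h | h
  · obtain rfl : j = i := Subtype.ext h
    exact ⟨1, rfl⟩
  · exact (conicChart_mem_range_neg_iff h 1).2 one_ne_zero

end PeriodDomain

/-- The period domain `Ω_{3,n}` is simply connected. -/
theorem Omega_simplyConnected (n : ℕ) (hn : 1 ≤ n) :
    SimplyConnectedSpace ↥(Omega n) := by
  exact (omegaHomotopyEquivConic n).simplyConnectedSpace

end
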